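/- For all real numbers a, b > 0 with a ≠ b, the double inequality Q(a,b)^{1/3}·A(a,b)^{2/3} < M(a,b) < Q(a,b)/3 + 2·A(a,b)/3 holds. -/

import Mathlib

noncomputable def M (a b : ℝ) : ℝ := (a - b) / (2 * Real.arsinh ((a - b) / (a + b)))
noncomputable def A (a b : ℝ) : ℝ := (a + b) / 2
noncomputable def Q (a b : ℝ) : ℝ := Real.sqrt ((a ^ 2 + b ^ 2) / 2)

lemma strictMonoOn_Ici_of_hasDerivAt_pos {f f' : ℝ → ℝ} (hf : ∀ t, HasDerivAt f (f' t) t)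
    (hpos : ∀ t, 0 < t → 0 < f' t) : StrictMonoOn f (Set.Ici 0) := by
  refine strictMonoOn_of_deriv_pos (convex_Ici 0)
    (fun t _ => (hf t).continuousAt.continuousWithinAt) fun t ht => ?_
  rw [interior_Ici] at ht
  rw [(hf t).deriv]
  exact hpos t ht

lemma pos_of_hasDerivAt_pos {f f' : ℝ → ℝ} (hf : ∀ t, HasDerivAt f (f' t) t)
    (hpos : ∀ t, 0 < t → 0 < f' t) (h0 : f 0 = 0) {t : ℝ} (ht : 0 < t) : 0 < f t := by
  simpa [h0] using
    strictMonoOn_Ici_of_hasDerivAt_pos hf hpos Set.self_mem_Ici (Set.mem_Ici.2 ht.le) ht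

lemma sinh_lt_mul_cosh {t : ℝ} (ht : 0 < t) : Real.sinh t < t * Real.cosh t := by
  refine sub_pos.1 (pos_of_hasDerivAt_pos (f := fun t => t * Real.cosh t - Real.sinh t)
    (f' := fun t => t * Real.sinh t) (fun t => ?_)
    (fun t ht => mul_pos ht (Real.sinh_pos_iff.2 ht)) (by simp) ht)
  exact (((hasDerivAt_id t).mul (Real.hasDerivAt_cosh t)).sub (Real.hasDerivAt_sinh t))
    |>.congr_deriv (by
      simp only [id]
      ring)

lemma two_mul_cosh_sub_one_lt {t : ℝ} (ht : 0 < t) :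
    2 * (Real.cosh t - 1) < t * Real.sinh t := by
  refine sub_pos.1 (pos_of_hasDerivAt_pos
    (f := fun t => t * Real.sinh t - 2 * (Real.cosh t - 1))
    (f' := fun t => t * Real.cosh t - Real.sinh t) (fun t => ?_)
    (fun t ht => sub_pos.2 (sinh_lt_mul_cosh ht)) (by simp) ht)
  exact (((hasDerivAt_id t).mul (Real.hasDerivAt_sinh t)).sub
    (((Real.hasDerivAt_cosh t).sub_const 1).const_mul 2))
    |>.congr_deriv (by
      simp only [id]
      ring)

lemma three_mul_sinh_lt {t : ℝ} (ht : 0 < t) :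
    3 * Real.sinh t < t * (Real.cosh t + 2) := by
  refine sub_pos.1 (pos_of_hasDerivAt_pos
    (f := fun t => t * (Real.cosh t + 2) - 3 * Real.sinh t)
    (f' := fun t => t * Real.sinh t - 2 * (Real.cosh t - 1)) (fun t => ?_)
    (fun t ht => sub_pos.2 (two_mul_cosh_sub_one_lt ht)) (by simp) ht)
  exact (((hasDerivAt_id t).mul ((Real.hasDerivAt_cosh t).add_const 2)).sub
    ((Real.hasDerivAt_sinh t).const_mul 3))
    |>.congr_deriv (by
      simp only [id]
      ring)

lemma lt_sinh_mul_cosh_rpow {t : ℝ} (ht : 0 < t) :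
    t < Real.sinh t * Real.cosh t ^ (-(1 : ℝ) / 3) := by
  refine sub_pos.1 (pos_of_hasDerivAt_pos
    (f := fun t => Real.sinh t * Real.cosh t ^ (-(1 : ℝ) / 3) - t)
    (f' := fun t => Real.cosh t * Real.cosh t ^ (-(1 : ℝ) / 3) + Real.sinh t *
      (Real.sinh t * (-(1 : ℝ) / 3) * Real.cosh t ^ (-(1 : ℝ) / 3 - 1)) - 1) (fun t => ?_)
    (fun t ht => ?_) (by simp) ht)
  · exact ((Real.hasDerivAt_sinh t).mul ((Real.hasDerivAt_cosh t).rpow_const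
      (Or.inl (Real.cosh_pos t).ne'))).sub (hasDerivAt_id t)
  · have hc : 0 < Real.cosh t := Real.cosh_pos t
    have hc1 : 1 < Real.cosh t := Real.one_lt_cosh.2 ht.ne'
    have hs : Real.sinh t ^ 2 = Real.cosh t ^ 2 - 1 := Real.sinh_sq t
    obtain ⟨v, hv, hvc⟩ : ∃ v : ℝ, 0 < v ∧ v ^ 3 = Real.cosh t :=
      ⟨Real.cosh t ^ ((1 : ℝ) / 3), by positivity, by
        rw [← Real.rpow_natCast, ← Real.rpow_mul hc.le]; norm_num⟩
    have hv1 : 1 < v := by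
      by_contra! h
      exact absurd hc1 (not_lt.2 (hvc ▸ pow_le_one₀ hv.le h))
    have h1 : Real.cosh t ^ (-(1 : ℝ) / 3) = v⁻¹ := by
      rw [← hvc, ← Real.rpow_natCast, ← Real.rpow_mul hv.le, ← Real.rpow_neg_one]
      norm_num
    rw [Real.rpow_sub_one hc.ne', h1]
    have key : Real.cosh t * v⁻¹ + Real.sinh t * (Real.sinh t * (-(1 : ℝ) / 3) *
        (v⁻¹ / Real.cosh t)) - 1 = (v ^ 2 - 1) ^ 2 * (2 * v ^ 2 + 1) / (3 * v ^ 4) := by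
      have : Real.sinh t * (Real.sinh t * (-(1 : ℝ) / 3) * (v⁻¹ / Real.cosh t)) =
          Real.sinh t ^ 2 * (-(1 : ℝ) / 3) * (v⁻¹ / Real.cosh t) := by ring
      rw [this, hs, ← hvc]
      field_simp
      ring
    rw [key]
    have : 0 < v ^ 2 - 1 := by nlinarith
    positivity

lemma cosh_rpow_lt_sinh_div_self {t : ℝ} (ht : t ≠ 0) :
    Real.cosh t ^ ((1 : ℝ) / 3) < Real.sinh t / t := by
  wlog h : 0 < t generalizing t
  · simpa using this (neg_ne_zero.2 ht) (neg_pos.2 (lt_of_le_of_ne (not_lt.1 h) ht))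
  have h1 := lt_sinh_mul_cosh_rpow h
  rw [neg_div, Real.rpow_neg (Real.cosh_pos t).le, ← div_eq_mul_inv,
    lt_div_iff₀ (Real.rpow_pos_of_pos (Real.cosh_pos t) _)] at h1
  rw [lt_div_iff₀ h]
  linarith

lemma sinh_div_self_lt {t : ℝ} (ht : t ≠ 0) :
    Real.sinh t / t < (Real.cosh t + 2) / 3 := by
  wlog h : 0 < t generalizing t
  · simpa using this (neg_ne_zero.2 ht) (neg_pos.2 (lt_of_le_of_ne (not_lt.1 h) ht))
  rw [div_lt_iff₀ h]
  linarith [three_mul_sinh_lt h]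

theorem stmt_18 (a b : ℝ) (ha : 0 < a) (hb : 0 < b) (hab : a ≠ b) :
    Q a b ^ ((1 : ℝ)/3) * A a b ^ ((2 : ℝ)/3) < M a b ∧
      M a b < Q a b / 3 + 2 * A a b / 3 := by
  have hA : 0 < A a b := by unfold A; positivity
  set t := Real.arsinh ((a - b) / (a + b)) with ht
  have hs : Real.sinh t = (a - b) / (a + b) := Real.sinh_arsinh _
  have ht0 : t ≠ 0 := by
    rw [ht, Ne, Real.arsinh_eq_zero_iff]
    exact div_ne_zero (sub_ne_zero.2 hab) (by positivity)
  have hc : 0 < Real.cosh t := Real.cosh_pos t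
  have hM : M a b = A a b * (Real.sinh t / t) := by
    rw [hs, M, ← ht, A]
    field_simp
  have hQ : Q a b = A a b * Real.cosh t := by
    have hsq : (a ^ 2 + b ^ 2) / 2 = (A a b * Real.cosh t) ^ 2 := by
      rw [mul_pow, Real.cosh_sq, hs, A]
      field_simp
      ring
    rw [Q, hsq, Real.sqrt_sq (by positivity)]
  rw [hM, hQ]
  constructor
  · have hQA : (A a b * Real.cosh t) ^ ((1 : ℝ) / 3) * A a b ^ ((2 : ℝ) / 3) =
        A a b * Real.cosh t ^ ((1 : ℝ) / 3) := by
      rw [Real.mul_rpow hA.le hc.le, mul_right_comm, ← Real.rpow_add hA]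
      norm_num
    rw [hQA]
    exact mul_lt_mul_of_pos_left (cosh_rpow_lt_sinh_div_self ht0) hA
  · calc A a b * (Real.sinh t / t) < A a b * ((Real.cosh t + 2) / 3) :=
          mul_lt_mul_of_pos_left (sinh_div_self_lt ht0) hA
      _ = _ := by ring
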